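/- Let p ≥ 5 be an odd integer and let T̂ = T + E ∈ ⊗^p ℝ^n, where T = Σ_{i=1}^n λ_i v_i^⊗p is SOD with λ_i > 0 for all i, {v₁,…,v_n} an orthonormal basis of ℝ^n, and E is a symmetric tensor with operator norm ε := ‖E‖. Let x̂ be a maximizer of T̂ x^⊗p over unit vectors x and let λ̂ := T̂ x̂^⊗p. Then there exists j ∈ {1,…,n} such that |λ̂ − λ_j| ≤ ε and ‖x̂ − v_j‖₂ ≤ 8ε/λ_j + 4(ε/λ_j)². -/

import Mathlib

open scoped RealInnerProductSpace BigOperators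

/-- The symmetric rank-one tensor `v^⊗p`, with entries `v_{i₁} ⋯ v_{i_p}`. -/
noncomputable def tpow {n : ℕ} (p : ℕ) (v : EuclideanSpace ℝ (Fin n)) : (Fin p → Fin n) → ℝ :=
  fun idx => ∏ k, v (idx k)

/-- `T x^⊗p = ∑_{i₁,…,i_p} T_{i₁,…,i_p} x_{i₁} ⋯ x_{i_p}`. -/
noncomputable def tapply {p n : ℕ} (T : (Fin p → Fin n) → ℝ) (x : EuclideanSpace ℝ (Fin n)) : ℝ :=
  ∑ idx : Fin p → Fin n, T idx * ∏ k, x (idx k)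

/-- A tensor is symmetric if its entries are invariant under all permutations of the indices. -/
def tsymm {p n : ℕ} (T : (Fin p → Fin n) → ℝ) : Prop :=
  ∀ (σ : Equiv.Perm (Fin p)) (idx : Fin p → Fin n), T (idx ∘ σ) = T idx

/-- Operator norm of a (symmetric) tensor: `sup_{‖x‖₂=1} |T x^⊗p|`. -/
noncomputable def tnorm {p n : ℕ} (T : (Fin p → Fin n) → ℝ) : ℝ :=
  sSup {r | ∃ x : EuclideanSpace ℝ (Fin n), ‖x‖ = 1 ∧ |tapply T x| = r}

/-- The nodes (angles) of Riesz's interpolation formula for degree `p`. -/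
noncomputable def rieszNode (p k : ℕ) : ℝ := (2 * k + 1) * Real.pi / (2 * p)

/-- The weights of Riesz's interpolation formula. -/
noncomputable def rieszWeight (p k : ℕ) : ℝ :=
  (-1) ^ k / (p * (2 - 2 * Real.cos (rieszNode p k)))

/-- The value of Riesz's quadrature at the exponential of frequency `m`. -/
noncomputable def rieszSum (p : ℕ) (m : ℤ) : ℂ :=
  ∑ k ∈ Finset.range (2 * p), (rieszWeight p k : ℂ) * Complex.exp (m * rieszNode p k * Complex.I)

lemma cos_rieszNode_lt_one {p k : ℕ} (hk : k < 2 * p) : Real.cos (rieszNode p k) < 1 := by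
  have hp : (0 : ℝ) < p := by exact_mod_cast (by omega : 0 < p)
  have hk' : (k : ℝ) + 1 ≤ 2 * p := by exact_mod_cast hk
  have hpi := Real.pi_pos
  have h0 : 0 < rieszNode p k := by unfold rieszNode; positivity
  have h1 : rieszNode p k < 2 * Real.pi := by
    unfold rieszNode
    rw [div_lt_iff₀ (by positivity)]
    nlinarith
  refine lt_of_le_of_ne (Real.cos_le_one _) fun h => ?_
  rw [Real.cos_eq_one_iff_of_lt_of_lt (by linarith) h1] at h
  exact h0.ne' h

lemma exp_mul_rieszNode_self {p : ℕ} (hp : 0 < p) (k : ℕ) :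
    Complex.exp (p * rieszNode p k * Complex.I) = (-1) ^ k * Complex.I := by
  have hp' : (p : ℂ) ≠ 0 := by exact_mod_cast hp.ne'
  have : (p * rieszNode p k * Complex.I : ℂ)
      = k * (Real.pi * Complex.I) + Real.pi / 2 * Complex.I := by
    simp only [rieszNode]; push_cast; field_simp
  rw [this, Complex.exp_add, Complex.exp_nat_mul, Complex.exp_pi_mul_I, Complex.exp_pi_div_two_mul_I]

lemma rieszSum_neg (p : ℕ) (m : ℤ) : rieszSum p (-m) = -rieszSum p m := by
  rcases Nat.eq_zero_or_pos p with rfl | hp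
  · simp [rieszSum]
  have hp' : (p : ℂ) ≠ 0 := by exact_mod_cast hp.ne'
  have hpr : (p : ℝ) ≠ 0 := by exact_mod_cast hp.ne'
  unfold rieszSum
  rw [← Finset.sum_range_reflect, ← Finset.sum_neg_distrib]
  refine Finset.sum_congr rfl fun k hk => ?_
  have hk := Finset.mem_range.1 hk
  have hnode : rieszNode p (2 * p - 1 - k) = 2 * Real.pi - rieszNode p k := by
    unfold rieszNode
    rw [show 2 * p - 1 - k = 2 * p - (1 + k) by omega, Nat.cast_sub (by omega)]
    push_cast; field_simp; ring
  have hsign : (-1 : ℝ) ^ (2 * p - 1 - k) = -(-1) ^ k := by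
    rcases Nat.even_or_odd k with h | h
    · rw [h.neg_one_pow, Odd.neg_one_pow]
      rw [Nat.even_iff] at h; rw [Nat.odd_iff]; omega
    · rw [h.neg_one_pow, Even.neg_one_pow]
      · simp
      rw [Nat.odd_iff] at h; rw [Nat.even_iff]; omega
  have hw : rieszWeight p (2 * p - 1 - k) = -rieszWeight p k := by
    unfold rieszWeight
    rw [hnode, hsign, Real.cos_two_pi_sub, neg_div]
  rw [hw, hnode]
  have : ((-m : ℤ) * (2 * Real.pi - rieszNode p k : ℝ) * Complex.I : ℂ)
      = m * rieszNode p k * Complex.I + (-m : ℤ) * (2 * Real.pi * Complex.I) := by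
    push_cast; ring
  rw [this, Complex.exp_add, Complex.exp_int_mul_two_pi_mul_I]
  push_cast; ring

lemma rieszSum_second_difference {p : ℕ} (hp : 0 < p) (m : ℤ) :
    rieszSum p (m + 1) - 2 * rieszSum p m + rieszSum p (m - 1)
      = -(1 / p) * ∑ k ∈ Finset.range (2 * p),
          (-1) ^ k * Complex.exp (m * rieszNode p k * Complex.I) := by
  have hp' : (p : ℂ) ≠ 0 := by exact_mod_cast hp.ne'
  unfold rieszSum
  rw [Finset.mul_sum, Finset.mul_sum, ← Finset.sum_sub_distrib, ← Finset.sum_add_distrib]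
  refine Finset.sum_congr rfl fun k hk => ?_
  have hc := cos_rieszNode_lt_one (Finset.mem_range.1 hk)
  have hc' : ((2 - 2 * Real.cos (rieszNode p k) : ℝ) : ℂ) ≠ 0 := by
    exact Complex.ofReal_ne_zero.2 (by linarith)
  set t := rieszNode p k with ht
  have h1 : Complex.exp (((m + 1 : ℤ) : ℂ) * t * Complex.I)
      = Complex.exp (m * t * Complex.I) * Complex.exp (t * Complex.I) := by
    rw [← Complex.exp_add]; push_cast; ring_nf
  have h2 : Complex.exp (((m - 1 : ℤ) : ℂ) * t * Complex.I)
      = Complex.exp (m * t * Complex.I) * Complex.exp (-t * Complex.I) := by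
    rw [← Complex.exp_add]; push_cast; ring_nf
  have h3 : Complex.exp (t * Complex.I) + Complex.exp (-t * Complex.I)
      = (2 * Real.cos t : ℝ) := by
    push_cast
    rw [Complex.two_cos]
  have hw : (rieszWeight p k : ℂ) * (2 - 2 * Real.cos t : ℝ) = (-1) ^ k / p := by
    have hw' : rieszWeight p k = (-1) ^ k / (p * (2 - 2 * Real.cos t)) := rfl
    rw [hw', Complex.ofReal_div, Complex.ofReal_mul, div_mul_eq_mul_div,
      mul_div_mul_right _ _ hc']
    push_cast; rfl
  rw [h1, h2]
  have : (2 * Real.cos t : ℝ) = (2 : ℂ) - (2 - 2 * Real.cos t : ℝ) := by push_cast; ring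
  rw [this] at h3
  linear_combination (rieszWeight p k : ℂ) * Complex.exp (m * t * Complex.I) * h3
    - Complex.exp (m * t * Complex.I) * hw

lemma sum_neg_one_pow_mul_exp_rieszNode {p : ℕ} {m : ℤ} (hm : |m| < p) :
    ∑ k ∈ Finset.range (2 * p), (-1) ^ k * Complex.exp (m * rieszNode p k * Complex.I) = 0 := by
  have hp : 0 < p := by have := abs_nonneg m; omega
  have hp' : (p : ℂ) ≠ 0 := by exact_mod_cast hp.ne'
  have hpi : (Real.pi : ℂ) ≠ 0 := by exact_mod_cast Real.pi_ne_zero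
  set r : ℂ := Complex.exp ((m + p) * Real.pi / p * Complex.I) with hr
  have hterm : ∀ k ∈ Finset.range (2 * p),
      (-1) ^ k * Complex.exp (m * rieszNode p k * Complex.I)
        = Complex.exp (m * Real.pi / (2 * p) * Complex.I) * r ^ k := by
    intro k _
    rw [hr, ← Complex.exp_nat_mul, ← Complex.exp_pi_mul_I, ← Complex.exp_nat_mul,
      ← Complex.exp_add, ← Complex.exp_add]
    congr 1
    simp only [rieszNode]; push_cast; field_simp; ring
  have hr1 : r ≠ 1 := by
    rw [hr, Ne, Complex.exp_eq_one_iff]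
    rintro ⟨n, hn⟩
    have h1 : ((m + p : ℤ) : ℂ) = ((2 * p * n : ℤ) : ℂ) := by
      have hI := Complex.I_ne_zero
      field_simp at hn
      push_cast
      linear_combination hn
    have h2 : m + p = 2 * p * n := by exact_mod_cast h1
    rw [abs_lt] at hm
    have h3 : 0 < n := by by_contra! h; nlinarith
    have h4 : n < 1 := by by_contra! h; nlinarith
    omega
  have hr2 : r ^ (2 * p) = 1 := by
    rw [hr, ← Complex.exp_nat_mul, Complex.exp_eq_one_iff]
    exact ⟨m + p, by push_cast; field_simp⟩
  rw [Finset.sum_congr rfl hterm, ← Finset.mul_sum, geom_sum_eq hr1, hr2]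
  simp

lemma rieszSum_natCast {p : ℕ} (n : ℕ) (hn : n ≤ p) :
    rieszSum p n = n * rieszSum p 1 := by
  have h0 : rieszSum p 0 = 0 := by
    have := rieszSum_neg p 0
    rw [neg_zero] at this
    exact self_eq_neg.1 this
  induction n using Nat.strong_induction_on with
  | _ n ih =>
    match n with
    | 0 => simp [h0]
    | 1 => simp
    | n + 2 =>
      have h1 := ih (n + 1) (by omega) (by omega)
      have h2 := ih n (by omega) (by omega)
      have hd := rieszSum_second_difference (p := p) (by omega) (n + 1 : ℤ)
      rw [sum_neg_one_pow_mul_exp_rieszNode (by rw [abs_of_nonneg (by positivity)]; omega)] at hd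
      push_cast at h1 h2 hd ⊢
      rw [show (n + 1 + 1 : ℤ) = n + 2 by ring, show (n + 1 - 1 : ℤ) = n by ring] at hd
      linear_combination hd + 2 * h1 - h2

lemma rieszSum_one {p : ℕ} (hp : 0 < p) : rieszSum p 1 = Complex.I := by
  have hp' : (p : ℂ) ≠ 0 := by exact_mod_cast hp.ne'
  have hd := rieszSum_second_difference hp p
  have hs : ∑ k ∈ Finset.range (2 * p),
      (-1) ^ k * Complex.exp (((p : ℤ) : ℂ) * rieszNode p k * Complex.I)
        = 2 * p * Complex.I := by
    rw [Finset.sum_congr rfl (g := fun _ => Complex.I)]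
    · simp
    intro k _
    rw [Int.cast_natCast, exp_mul_rieszNode_self hp, ← mul_assoc, ← mul_pow]
    simp
  have hrefl : rieszSum p (p + 1) = -rieszSum p (-(p - 1)) := by
    unfold rieszSum
    rw [← Finset.sum_neg_distrib]
    refine Finset.sum_congr rfl fun k _ => ?_
    have : (((p + 1 : ℤ) : ℂ) * rieszNode p k * Complex.I)
        = ((-(p - 1) : ℤ) : ℂ) * rieszNode p k * Complex.I
          + (p * rieszNode p k * Complex.I + p * rieszNode p k * Complex.I) := by
      push_cast; ring
    rw [this, Complex.exp_add, Complex.exp_add _ (p * rieszNode p k * Complex.I),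
      exp_mul_rieszNode_self hp]
    have h1 : ((-1 : ℂ) ^ k) * (-1) ^ k = 1 := by rw [← mul_pow]; simp
    linear_combination (rieszWeight p k : ℂ)
      * Complex.exp (((-(p - 1) : ℤ) : ℂ) * rieszNode p k * Complex.I)
      * (Complex.I ^ 2 * h1 + Complex.I_sq)
  rw [hs, hrefl, rieszSum_neg] at hd
  have h1 := rieszSum_natCast p le_rfl
  have h2 := rieszSum_natCast (p := p) (p - 1) (by omega)
  rw [Nat.cast_sub (by omega), Nat.cast_sub (by omega)] at h2
  push_cast at h2
  rw [h1, h2] at hd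
  field_simp at hd
  linear_combination (-1 / 2 : ℂ) * hd

/-- Riesz's quadrature computes the derivative at `0` of exponentials of frequency at most `p`. -/
lemma rieszSum_eq {p : ℕ} (hp : 0 < p) {m : ℤ} (hm : |m| ≤ p) :
    rieszSum p m = m * Complex.I := by
  obtain ⟨n, rfl | rfl⟩ := m.eq_nat_or_neg
  · rw [rieszSum_natCast n (by simpa using hm), rieszSum_one hp]; simp
  · rw [rieszSum_neg, rieszSum_natCast n (by simpa using hm), rieszSum_one hp]; simp

lemma sum_abs_rieszWeight {p : ℕ} (hp : 0 < p) :
    ∑ k ∈ Finset.range (2 * p), |rieszWeight p k| = p := by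
  have h := rieszSum_eq hp (m := p) (by simp)
  have h2 : rieszSum p p
      = ((∑ k ∈ Finset.range (2 * p), |rieszWeight p k| : ℝ) : ℂ) * Complex.I := by
    unfold rieszSum
    push_cast
    rw [Finset.sum_mul]
    refine Finset.sum_congr rfl fun k hk => ?_
    have hc := cos_rieszNode_lt_one (Finset.mem_range.1 hk)
    have habs : |rieszWeight p k| = rieszWeight p k * (-1) ^ k := by
      have hpos : (0 : ℝ) < p * (2 - 2 * Real.cos (rieszNode p k)) :=
        mul_pos (by exact_mod_cast hp) (by linarith)
      have h1 : ((-1 : ℝ) ^ k) * (-1) ^ k = 1 := by rw [← mul_pow]; simp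
      unfold rieszWeight
      rw [abs_div, abs_of_pos hpos, abs_neg_one_pow, div_mul_eq_mul_div, h1]
    rw [exp_mul_rieszNode_self hp, habs]
    push_cast; ring
  rw [h2] at h
  have := mul_right_cancel₀ Complex.I_ne_zero h
  exact_mod_cast this

/-- Trigonometric polynomials of degree at most `p`, as functions of a real angle. -/
def trigPoly (p : ℕ) : Submodule ℂ (ℝ → ℂ) :=
  Submodule.span ℂ {g | ∃ m : ℤ, |m| ≤ p ∧ g = fun θ : ℝ => Complex.exp (m * θ * Complex.I)}

lemma hasDerivAt_zero_of_mem_trigPoly {p : ℕ} (hp : 0 < p) {g : ℝ → ℂ} (hg : g ∈ trigPoly p) :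
    HasDerivAt g (∑ k ∈ Finset.range (2 * p), (rieszWeight p k : ℂ) * g (rieszNode p k)) 0 := by
  induction hg using Submodule.span_induction with
  | mem g hg =>
    obtain ⟨m, hm, rfl⟩ := hg
    have h1 : HasDerivAt (fun θ : ℝ => (m * θ * Complex.I : ℂ)) (m * 1 * Complex.I) 0 :=
      ((Complex.ofRealCLM.hasDerivAt (x := 0)).const_mul (m : ℂ)).mul_const Complex.I
    refine h1.cexp.congr_deriv ?_
    have h2 := rieszSum_eq hp hm
    unfold rieszSum at h2
    rw [h2]
    simp
  | zero => exact (hasDerivAt_const (0 : ℝ) (0 : ℂ)).congr_deriv (by simp)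
  | add f g _ _ hf hg =>
    refine (hf.add hg).congr_deriv ?_
    simp [mul_add, Finset.sum_add_distrib]
  | smul a g _ hg =>
    refine (hg.const_smul a).congr_deriv ?_
    simp only [Pi.smul_apply, smul_eq_mul, Finset.mul_sum]
    exact Finset.sum_congr rfl fun _ _ => by ring

/-- Bernstein's inequality for a real trigonometric polynomial, at the point `0`. -/
lemma exists_hasDerivAt_zero_abs_le {p : ℕ} (hp : 0 < p) {F : ℝ → ℝ}
    (hF : (fun θ => (F θ : ℂ)) ∈ trigPoly p) {M : ℝ} (hM : ∀ θ, |F θ| ≤ M) :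
    ∃ d, HasDerivAt F d 0 ∧ |d| ≤ p * M := by
  refine ⟨∑ k ∈ Finset.range (2 * p), rieszWeight p k * F (rieszNode p k), ?_, ?_⟩
  · have h := hasDerivAt_zero_of_mem_trigPoly hp hF
    have h2 := Complex.reCLM.hasFDerivAt.comp_hasDerivAt (0 : ℝ) h
    refine h2.congr_deriv ?_
    simp only [Complex.reCLM_apply, Complex.re_sum, Complex.re_ofReal_mul, Complex.ofReal_re]
  · rw [← sum_abs_rieszWeight hp, Finset.sum_mul]
    refine (Finset.abs_sum_le_sum_abs _ _).trans (Finset.sum_le_sum fun k _ => ?_)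
    rw [abs_mul]
    exact mul_le_mul_of_nonneg_left (hM _) (abs_nonneg _)

lemma prod_cos_add_sin_mem_trigPoly (p : ℕ) (a b : Fin p → ℝ) :
    (fun θ : ℝ => ((∏ k, (Real.cos θ * a k + Real.sin θ * b k) : ℝ) : ℂ)) ∈ trigPoly p := by
  have h : (fun θ : ℝ => ((∏ k, (Real.cos θ * a k + Real.sin θ * b k) : ℝ) : ℂ))
      = ∑ t ∈ (Finset.univ : Finset (Fin p)).powerset,
        ((∏ k ∈ t, ((a k - b k * Complex.I) / 2)) *
          ∏ k ∈ Finset.univ \ t, ((a k + b k * Complex.I) / 2)) •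
        fun θ : ℝ => Complex.exp (((t.card - (Finset.univ \ t).card : ℤ) : ℂ) * θ * Complex.I) := by
    funext θ
    push_cast
    have hfac : ∀ k : Fin p, (Complex.cos θ * a k + Complex.sin θ * b k : ℂ)
        = (a k - b k * Complex.I) / 2 * Complex.exp (θ * Complex.I)
          + (a k + b k * Complex.I) / 2 * Complex.exp (-(θ * Complex.I)) := by
      intro k
      rw [← neg_mul, Complex.exp_mul_I, Complex.exp_mul_I, Complex.cos_neg, Complex.sin_neg]
      linear_combination (Complex.sin θ * b k) * Complex.I_sq
    rw [Finset.prod_congr rfl fun k _ => hfac k, Finset.prod_add, Finset.sum_apply]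
    refine Finset.sum_congr rfl fun t _ => ?_
    rw [Finset.prod_mul_distrib, Finset.prod_mul_distrib, Finset.prod_const, Finset.prod_const,
      ← Complex.exp_nat_mul, ← Complex.exp_nat_mul, mul_mul_mul_comm, ← Complex.exp_add,
      Pi.smul_apply, smul_eq_mul]
    congr 2
    ring
  rw [h]
  refine Submodule.sum_mem _ fun t _ => Submodule.smul_mem _ _ (Submodule.subset_span ⟨_, ?_, rfl⟩)
  have := Finset.card_sdiff_add_card_eq_card (Finset.subset_univ t)
  rw [Finset.card_univ, Fintype.card_fin] at this
  rw [abs_le]; omega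

lemma tapply_tpow {n : ℕ} (p : ℕ) (v x : EuclideanSpace ℝ (Fin n)) :
    tapply (tpow p v) x = ⟪v, x⟫ ^ p := by
  simp only [tapply, tpow, ← Finset.prod_mul_distrib]
  rw [← Fintype.sum_pow (fun i => v i * x i)]
  congr 1
  rw [PiLp.inner_apply]
  exact Finset.sum_congr rfl fun i _ => by simp [mul_comm]

lemma tapply_sum_smul_tpow_add {p n : ℕ} (lam : Fin n → ℝ) (v : Fin n → EuclideanSpace ℝ (Fin n))
    (E : (Fin p → Fin n) → ℝ) (x : EuclideanSpace ℝ (Fin n)) :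
    tapply ((∑ i, lam i • tpow p (v i)) + E) x = ∑ i, lam i * ⟪v i, x⟫ ^ p + tapply E x := by
  simp only [← tapply_tpow]
  simp only [tapply, Pi.add_apply, Finset.sum_apply, Pi.smul_apply, smul_eq_mul, add_mul,
    Finset.sum_add_distrib, Finset.mul_sum, Finset.sum_mul]
  rw [Finset.sum_comm]
  simp only [mul_assoc]

lemma abs_tapply_le_tnorm {p n : ℕ} (T : (Fin p → Fin n) → ℝ) {x : EuclideanSpace ℝ (Fin n)}
    (hx : ‖x‖ = 1) : |tapply T x| ≤ tnorm T := by
  refine le_csSup ⟨∑ idx, |T idx|, ?_⟩ ⟨x, hx, rfl⟩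
  rintro _ ⟨y, hy, rfl⟩
  refine (Finset.abs_sum_le_sum_abs _ _).trans (Finset.sum_le_sum fun idx _ => ?_)
  rw [abs_mul, Finset.abs_prod]
  refine mul_le_of_le_one_right (abs_nonneg _) (Finset.prod_le_one (fun _ _ => abs_nonneg _) ?_)
  intro k _
  have := PiLp.norm_apply_le y (idx k)
  rwa [hy] at this

lemma norm_cos_smul_add_sin_smul {H : Type*} [NormedAddCommGroup H] [InnerProductSpace ℝ H]
    {x u : H} (hx : ‖x‖ = 1) (hu : ‖u‖ = 1) (hxu : ⟪x, u⟫ = 0) (θ : ℝ) :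
    ‖Real.cos θ • x + Real.sin θ • u‖ = 1 := by
  have h : ‖Real.cos θ • x + Real.sin θ • u‖ ^ 2 = 1 := by
    rw [norm_add_sq_real, norm_smul, norm_smul, hx, hu, real_inner_smul_left,
      real_inner_smul_right, hxu]
    simp
  exact (pow_eq_one_iff_of_nonneg (norm_nonneg _) two_ne_zero).1 h

/-- The restriction of a tensor to the great circle through `x` and `u` has derivative at `x` of
size at most `p` times the operator norm. -/
lemma exists_hasDerivAt_tapply_circle {p n : ℕ} (hp : 0 < p) (T : (Fin p → Fin n) → ℝ)
    {x u : EuclideanSpace ℝ (Fin n)} (hx : ‖x‖ = 1) (hu : ‖u‖ = 1) (hxu : ⟪x, u⟫ = 0) :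
    ∃ d, HasDerivAt (fun θ => tapply T (Real.cos θ • x + Real.sin θ • u)) d 0 ∧
      |d| ≤ p * tnorm T := by
  refine exists_hasDerivAt_zero_abs_le hp ?_ fun θ =>
    abs_tapply_le_tnorm T (norm_cos_smul_add_sin_smul hx hu hxu θ)
  have h : (fun θ : ℝ => (tapply T (Real.cos θ • x + Real.sin θ • u) : ℂ))
      = ∑ idx : Fin p → Fin n, (T idx : ℂ) • fun θ : ℝ =>
        ((∏ k, (Real.cos θ * x (idx k) + Real.sin θ * u (idx k)) : ℝ) : ℂ) := by
    funext θ
    simp [tapply]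
  rw [h]
  exact Submodule.sum_mem _ fun idx _ =>
    Submodule.smul_mem _ _ (prod_cos_add_sin_mem_trigPoly p _ _)

/-- First-order optimality of a maximizer `x` along the tangent direction `u`. -/
lemma abs_sum_mul_inner_pow_le_tnorm {p n : ℕ} (hp : 0 < p) (lam : Fin n → ℝ)
    (v : Fin n → EuclideanSpace ℝ (Fin n)) (E : (Fin p → Fin n) → ℝ)
    {x u : EuclideanSpace ℝ (Fin n)} (hx : ‖x‖ = 1) (hu : ‖u‖ = 1) (hxu : ⟪x, u⟫ = 0)
    (hmax : ∀ y : EuclideanSpace ℝ (Fin n), ‖y‖ = 1 →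
      ∑ i, lam i * ⟪v i, y⟫ ^ p + tapply E y ≤ ∑ i, lam i * ⟪v i, x⟫ ^ p + tapply E x) :
    |∑ i, lam i * ⟪v i, x⟫ ^ (p - 1) * ⟪v i, u⟫| ≤ tnorm E := by
  obtain ⟨d, hd, hdle⟩ := exists_hasDerivAt_tapply_circle hp E hx hu hxu
  have hp' : (0 : ℝ) < p := by exact_mod_cast hp
  have hlin : ∀ i, HasDerivAt (fun θ : ℝ => ⟪v i, Real.cos θ • x + Real.sin θ • u⟫)
      ⟪v i, u⟫ 0 := by
    intro i
    simp only [inner_add_right, real_inner_smul_right]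
    exact (((Real.hasDerivAt_cos 0).mul_const _).add
      ((Real.hasDerivAt_sin 0).mul_const _)).congr_deriv (by simp)
  have hsum : HasDerivAt
      (fun θ : ℝ => ∑ i, lam i * ⟪v i, Real.cos θ • x + Real.sin θ • u⟫ ^ p)
      (p * ∑ i, lam i * ⟪v i, x⟫ ^ (p - 1) * ⟪v i, u⟫) 0 := by
    refine (HasDerivAt.fun_sum fun i _ => ((hlin i).fun_pow p).const_mul (lam i)).congr_deriv ?_
    rw [Finset.mul_sum]
    exact Finset.sum_congr rfl fun i _ => by simp; ring
  have hext := IsLocalMax.hasDerivAt_eq_zero (Filter.Eventually.of_forall fun θ => by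
    simpa using hmax _ (norm_cos_smul_add_sin_smul hx hu hxu θ)) (hsum.add hd)
  have h1 : p * ∑ i, lam i * ⟪v i, x⟫ ^ (p - 1) * ⟪v i, u⟫ = -d := by linarith
  refine le_of_mul_le_mul_left ?_ hp'
  rw [← abs_of_pos hp', ← abs_mul, h1, abs_neg, abs_of_pos hp']
  exact hdle

lemma Orthonormal.sum_sq_inner_eq_norm_sq {n : ℕ} {v : Fin n → EuclideanSpace ℝ (Fin n)}
    (hv : Orthonormal ℝ v) (x : EuclideanSpace ℝ (Fin n)) : ∑ i, ⟪v i, x⟫ ^ 2 = ‖x‖ ^ 2 := by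
  rcases isEmpty_or_nonempty (Fin n) with h | h
  · simp [Subsingleton.elim x 0]
  have hspan : ⊤ ≤ Submodule.span ℝ (Set.range v) :=
    (hv.linearIndependent.span_eq_top_of_card_eq_finrank (by simp)).ge
  simpa using (OrthonormalBasis.mk hv hspan).sum_sq_norm_inner_right x

/-- First-order optimality of a maximizer `x` along the great circle through `x` and `v j`. -/
lemma abs_mul_pow_sub_mul_sum_le {p n : ℕ} (hp : 0 < p) (lam : Fin n → ℝ)
    {v : Fin n → EuclideanSpace ℝ (Fin n)} (hv : Orthonormal ℝ v) (E : (Fin p → Fin n) → ℝ)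
    {x : EuclideanSpace ℝ (Fin n)} (hx : ‖x‖ = 1)
    (hmax : ∀ y : EuclideanSpace ℝ (Fin n), ‖y‖ = 1 →
      ∑ i, lam i * ⟪v i, y⟫ ^ p + tapply E y ≤ ∑ i, lam i * ⟪v i, x⟫ ^ p + tapply E x)
    (j : Fin n) :
    |lam j * ⟪v j, x⟫ ^ (p - 1) - ⟪v j, x⟫ * ∑ i, lam i * ⟪v i, x⟫ ^ p|
      ≤ √(1 - ⟪v j, x⟫ ^ 2) * tnorm E := by
  set c := ⟪v j, x⟫ with hc
  set s := ‖v j - c • x‖ with hs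
  have hs2 : s ^ 2 = 1 - c ^ 2 := by
    rw [hs, norm_sub_sq_real, real_inner_smul_right, norm_smul, mul_pow, hx, hv.1 j, ← hc,
      Real.norm_eq_abs, sq_abs]
    ring
  have hval : ∑ i, lam i * ⟪v i, x⟫ ^ (p - 1) * ⟪v i, v j - c • x⟫
      = lam j * c ^ (p - 1) - c * ∑ i, lam i * ⟪v i, x⟫ ^ p := by
    have hterm : ∀ i, lam i * ⟪v i, x⟫ ^ (p - 1) * ⟪v i, v j - c • x⟫
        = lam i * ⟪v i, x⟫ ^ (p - 1) * ⟪v i, v j⟫ - c * (lam i * ⟪v i, x⟫ ^ p) := by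
      intro i
      rw [inner_sub_right, real_inner_smul_right, ← pow_sub_one_mul hp.ne' ⟪v i, x⟫]
      ring
    rw [Finset.sum_congr rfl fun i _ => hterm i, Finset.sum_sub_distrib,
      ← Finset.mul_sum, Finset.sum_eq_single j]
    · rw [real_inner_self_eq_norm_sq, hv.1 j]; simp [hc]
    · intro k _ hk
      rw [hv.2 hk, mul_zero]
    · simp
  rw [← hs2, Real.sqrt_sq (norm_nonneg _), ← hval]
  rcases eq_or_ne (v j - c • x) 0 with h0 | h0
  · simp [h0]
  have hs0 : 0 < s := norm_pos_iff.2 h0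
  have hu : ‖s⁻¹ • (v j - c • x)‖ = 1 := by
    rw [norm_smul, norm_inv, Real.norm_of_nonneg hs0.le, ← hs, inv_mul_cancel₀ hs0.ne']
  have hxu : ⟪x, s⁻¹ • (v j - c • x)⟫ = 0 := by
    rw [real_inner_smul_right, inner_sub_right, real_inner_smul_right, real_inner_self_eq_norm_sq,
      hx, real_inner_comm, ← hc]
    ring
  have hopt := abs_sum_mul_inner_pow_le_tnorm hp lam v E hx hu hxu hmax
  simp only [real_inner_smul_right, mul_left_comm _ s⁻¹, ← Finset.mul_sum] at hopt
  rwa [abs_mul, abs_inv, abs_of_pos hs0, inv_mul_le_iff₀ hs0] at hopt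

/-- Remark 2.5 of the paper. Let `p ≥ 5` be odd,
`T̂ = ∑ λᵢ vᵢ^⊗p + E` with `{vᵢ}` orthonormal, `λᵢ > 0`, `E` symmetric of operator
norm `ε`. Let `x̂` maximize `T̂ x^⊗p` over unit vectors and `λ̂ := T̂ x̂^⊗p`. Then there
exists `j` with `|λ̂ − λⱼ| ≤ ε` and `‖x̂ − vⱼ‖₂ ≤ 8 ε/λⱼ + 4 (ε/λⱼ)²`. -/
theorem sroa_single_rank_one_approximation_sharp
    {n : ℕ} (p : ℕ) (hodd : Odd p) (hp : 5 ≤ p)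
    (lam : Fin n → ℝ) (hlam : ∀ i, 0 < lam i)
    (v : Fin n → EuclideanSpace ℝ (Fin n)) (hv : Orthonormal ℝ v)
    (E : (Fin p → Fin n) → ℝ) (hE : tsymm E)
    (ε : ℝ) (hε : ε = tnorm E)
    (Th : (Fin p → Fin n) → ℝ) (hTh : Th = (∑ i, lam i • tpow p (v i)) + E)
    (xh : EuclideanSpace ℝ (Fin n)) (hxh : ‖xh‖ = 1)
    (hmax : ∀ y : EuclideanSpace ℝ (Fin n), ‖y‖ = 1 → tapply Th y ≤ tapply Th xh) :
    ∃ j : Fin n, |tapply Th xh - lam j| ≤ ε ∧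
      ‖xh - v j‖ ≤ 8 * (ε / lam j) + 4 * (ε / lam j)^2 := by
  subst hTh
  simp only [tapply_sum_smul_tpow_add] at hmax ⊢
  have hne : Nonempty (Fin n) := by
    rw [← Fin.pos_iff_nonempty]
    rcases Nat.eq_zero_or_pos n with rfl | h
    · exact absurd hxh (by simp [Subsingleton.elim xh 0])
    · exact h
  have hEx := abs_le.1 (hε ▸ abs_tapply_le_tnorm E hxh)
  have hε0 : 0 ≤ ε := by linarith
  have hparseval : ∑ i, ⟪v i, xh⟫ ^ 2 = 1 := by
    rw [hv.sum_sq_inner_eq_norm_sq, hxh, one_pow]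
  have hle1 : ∀ i, ⟪v i, xh⟫ ≤ 1 := fun i => by
    have := real_inner_le_norm (v i) xh
    rwa [hv.1 i, hxh, one_mul] at this
  obtain ⟨j, hj⟩ := Finite.exists_max fun i => lam i * ⟪v i, xh⟫ ^ (p - 2)
  have hoddq : Odd (p - 2) := by obtain ⟨k, rfl⟩ := hodd; exact ⟨k - 1, by omega⟩
  have hpow : ∀ t : ℝ, t ^ p = t ^ (p - 2) * t ^ 2 := fun t => by
    rw [← pow_add]; congr 1; omega
  have hpow1 : ∀ t : ℝ, t ^ (p - 1) = t ^ (p - 2) * t := fun t => by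
    rw [← pow_succ]; congr 1; omega
  have hupper : ∑ i, lam i * ⟪v i, xh⟫ ^ p ≤ lam j * ⟪v j, xh⟫ ^ (p - 2) := by
    calc ∑ i, lam i * ⟪v i, xh⟫ ^ p
        ≤ ∑ i, lam j * ⟪v j, xh⟫ ^ (p - 2) * ⟪v i, xh⟫ ^ 2 := by
          refine Finset.sum_le_sum fun i _ => ?_
          rw [hpow, ← mul_assoc]
          exact mul_le_mul_of_nonneg_right (hj i) (sq_nonneg _)
      _ = lam j * ⟪v j, xh⟫ ^ (p - 2) := by rw [← Finset.mul_sum, hparseval, mul_one]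
  have hlower : ∀ i, lam i - ε ≤ ∑ i, lam i * ⟪v i, xh⟫ ^ p + tapply E xh := by
    intro i
    have h1 := hmax (v i) (hv.1 i)
    have h2 := abs_le.1 (hε ▸ abs_tapply_le_tnorm E (hv.1 i))
    have h3 : ∑ k, lam k * ⟪v k, v i⟫ ^ p = lam i := by
      rw [Finset.sum_eq_single i]
      · rw [real_inner_self_eq_norm_sq, hv.1 i]; simp
      · intro k _ hk
        rw [hv.2 hk, zero_pow (by omega), mul_zero]
      · simp
    linarith
  set c := ⟪v j, xh⟫ with hc
  have hcq1 : c ^ (p - 2) ≤ 1 := by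
    rcases le_total 0 c with h | h
    · exact pow_le_one₀ h (hle1 j)
    · exact (hoddq.pow_nonpos h).trans zero_le_one
  have hL := hlam j
  refine ⟨j, abs_le.2 ⟨by linarith [hlower j], by nlinarith⟩, ?_⟩
  have hnorm : ‖xh - v j‖ ^ 2 = 2 - 2 * c := by
    rw [norm_sub_sq_real, hxh, hv.1 j, real_inner_comm]; ring
  set δ := ε / lam j with hδ
  have hδ0 : 0 ≤ δ := div_nonneg hε0 hL.le
  have hεδ : ε = δ * lam j := by rw [hδ]; field_simp
  have hcq : 1 - 2 * δ ≤ c ^ (p - 2) := by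
    have := hlower j
    refine le_of_mul_le_mul_left ?_ hL
    nlinarith
  have hcneg : -1 ≤ c := by
    have := neg_le_of_abs_le (abs_real_inner_le_norm (v j) xh)
    rwa [hv.1 j, hxh, one_mul] at this
  have hc1 : c ≤ 1 := hle1 j
  clear_value c δ
  have hB : 0 ≤ 8 * δ + 4 * δ ^ 2 := by positivity
  refine abs_le_of_sq_le_sq' ?_ hB |>.2
  rw [hnorm]
  rcases le_or_gt (1 / 4) δ with hbig | hδ4
  · nlinarith
  have hc0 : 0 < c := by
    by_contra! h
    linarith [hoddq.pow_nonpos h]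
  rcases le_or_gt (1 / 6) δ with hbig | hδ6
  · nlinarith
  have hc3 : 2 / 3 ≤ c ^ 3 := by
    have := pow_le_pow_of_le_one hc0.le hc1 (by omega : 3 ≤ p - 2)
    linarith
  have hc87 : 87 / 100 ≤ c := by
    by_contra! h
    have := pow_lt_pow_left₀ h hc0.le (by norm_num : 3 ≠ 0)
    norm_num at this
    linarith
  have hsplit : c ^ 2 + ∑ i ∈ Finset.univ.erase j, ⟪v i, xh⟫ ^ 2 = 1 := by
    rw [← hparseval, ← Finset.add_sum_erase _ _ (Finset.mem_univ j), ← hc]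
  have hsmall : ∀ i ∈ Finset.univ.erase j, lam i * ⟪v i, xh⟫ ^ (p - 2) ≤ (lam j + 2 * ε) / 8 := by
    intro i hi
    have h1 : ⟪v i, xh⟫ ^ 2 ≤ (1 / 2) ^ 2 := by
      have := Finset.single_le_sum (f := fun i => ⟪v i, xh⟫ ^ 2) (fun _ _ => sq_nonneg _) hi
      nlinarith
    have h2 : |⟪v i, xh⟫| ≤ 1 / 2 := abs_le_of_sq_le_sq h1 (by norm_num)
    have h3 : ⟪v i, xh⟫ ^ (p - 2) ≤ 1 / 8 := by
      calc ⟪v i, xh⟫ ^ (p - 2) ≤ |⟪v i, xh⟫| ^ (p - 2) := by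
            rw [← abs_pow]; exact le_abs_self _
        _ ≤ |⟪v i, xh⟫| ^ 3 := pow_le_pow_of_le_one (abs_nonneg _) (by linarith) (by omega)
        _ ≤ (1 / 2) ^ 3 := pow_le_pow_left₀ (abs_nonneg _) h2 3
        _ = 1 / 8 := by norm_num
    have h4 := hlower i
    have h5 := hlam i
    nlinarith
  rcases hc1.eq_or_lt with h1 | h1
  · rw [h1]; nlinarith
  have hopt := abs_mul_pow_sub_mul_sum_le (by omega) lam hv E hxh hmax j
  rw [← hε, ← hc] at hopt
  set s := √(1 - c ^ 2) with hs
  have hs2 : s ^ 2 = 1 - c ^ 2 := Real.sq_sqrt (by nlinarith)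
  have hs0 : 0 < s := Real.sqrt_pos.2 (by nlinarith)
  clear_value s
  have hsum : ∑ i, lam i * ⟪v i, xh⟫ ^ p
      ≤ lam j * c ^ (p - 2) * c ^ 2 + (lam j + 2 * ε) / 8 * s ^ 2 := by
    rw [← Finset.add_sum_erase _ _ (Finset.mem_univ j), ← hc, hpow c, ← mul_assoc]
    refine add_le_add_right ?_ _
    rw [hs2, show 1 - c ^ 2 = ∑ i ∈ Finset.univ.erase j, ⟪v i, xh⟫ ^ 2 by linarith,
      Finset.mul_sum]
    refine Finset.sum_le_sum fun i hi => ?_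
    rw [hpow, ← mul_assoc]
    exact mul_le_mul_of_nonneg_right (hsmall i hi) (sq_nonneg _)
  have hkey : c * s ^ 2 * (lam j * c ^ (p - 2) - (lam j + 2 * ε) / 8) ≤ s * ε := by
    have h2 := (le_abs_self _).trans hopt
    rw [hpow1 c] at h2
    have h3 := mul_le_mul_of_nonneg_left hsum hc0.le
    have h4 : c ^ 2 = 1 - s ^ 2 := by linarith
    rw [h4] at h3
    nlinarith
  have hgap : lam j / 2 ≤ lam j * c ^ (p - 2) - (lam j + 2 * ε) / 8 := by
    have h2 := mul_le_mul_of_nonneg_left hcq hL.le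
    have h3 := mul_le_mul_of_nonneg_right hδ6.le hL.le
    linarith
  have hsδ : s ≤ 4 * δ := by
    have h2 : c * s ^ 2 * (lam j / 2) ≤ s * ε :=
      (mul_le_mul_of_nonneg_left hgap (by positivity)).trans hkey
    rw [hεδ] at h2
    have h3 : (s * lam j) * (c * s / 2) ≤ (s * lam j) * δ := by linarith
    have h4 := le_of_mul_le_mul_left h3 (by positivity)
    have h5 := mul_le_mul_of_nonneg_right hc87 hs0.le
    linarith
  have h6 : s ^ 2 ≤ (4 * δ) ^ 2 := pow_le_pow_left₀ hs0.le hsδ 2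
  have h7 := mul_le_mul_of_nonneg_left hc1 hc0.le
  have h8 : 0 ≤ δ ^ 2 := by positivity
  have h11 : 0 ≤ δ ^ 3 := by positivity
  have h9 : 0 ≤ δ ^ 4 := by positivity
  linarith
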